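/- In any finite projective plane Π_q of order q ≥ 2, there exists a saturating set S with |S| ≤ ⌈√(3q·ln q)⌉ + ⌈(√q + 1)/2⌉, where the ceilings are taken of the indicated real numbers. -/

import Mathlib

/-- A finite projective plane of order `q`: any two distinct points lie on a
unique line, any two distinct lines meet in a unique point, there is a
nondegenerate quadrilateral, every line has `q+1` points, every point lies on
`q+1` lines, and there are `q^2+q+1` points and `q^2+q+1` lines. -/
structure ProjPlane (Point Line : Type*) (q : ℕ) where
  Incid : Point → Line → Prop
  exists_unique_line : ∀ ⦃p p' : Point⦄, p ≠ p' →
    ∃! l : Line, Incid p l ∧ Incid p' l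
  exists_unique_point : ∀ ⦃l l' : Line⦄, l ≠ l' →
    ∃! p : Point, Incid p l ∧ Incid p l'
  nondegenerate : ∃ a b c d : Point,
    a ≠ b ∧ a ≠ c ∧ a ≠ d ∧ b ≠ c ∧ b ≠ d ∧ c ≠ d ∧
    ∀ l : Line,
      ¬(Incid a l ∧ Incid b l ∧ Incid c l) ∧
      ¬(Incid a l ∧ Incid b l ∧ Incid d l) ∧
      ¬(Incid a l ∧ Incid c l ∧ Incid d l) ∧
      ¬(Incid b l ∧ Incid c l ∧ Incid d l)
  card_line_points : ∀ l : Line, Nat.card {p : Point // Incid p l} = q + 1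
  card_point_lines : ∀ p : Point, Nat.card {l : Line // Incid p l} = q + 1
  card_points : Nat.card Point = q ^ 2 + q + 1
  card_lines : Nat.card Line = q ^ 2 + q + 1

/-- A point `x` is saturated by a point set `S` if `x ∈ S` or some line
contains `x` and two distinct points of `S`. -/
def ProjPlane.Saturated {Point Line : Type*} {q : ℕ}
    (PP : ProjPlane Point Line q) (S : Set Point) (x : Point) : Prop :=
  x ∈ S ∨ ∃ l : Line, PP.Incid x l ∧
    ∃ a ∈ S, ∃ b ∈ S, a ≠ b ∧ PP.Incid a l ∧ PP.Incid b l

/-- A set of points is a saturating set if every point of the plane is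
saturated by it. -/
def ProjPlane.SaturatingSet {Point Line : Type*} {q : ℕ}
    (PP : ProjPlane Point Line q) (S : Set Point) : Prop :=
  ∀ x : Point, PP.Saturated S x

namespace ProjPlane

open Finset

variable {Point Line : Type*} {q : ℕ}

theorem Saturated.mono (PP : ProjPlane Point Line q) {S T : Set Point} (h : S ⊆ T) {x : Point}
    (hx : PP.Saturated S x) : PP.Saturated T x := by
  obtain hx | ⟨l, hl, a, ha, b, hb, hab⟩ := hx
  · exact Or.inl (h hx)
  · exact Or.inr ⟨l, hl, a, h ha, b, h hb, hab⟩

theorem exists_line (PP : ProjPlane Point Line q) {x y : Point} (h : x ≠ y) :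
    ∃ l, PP.Incid x l ∧ PP.Incid y l :=
  (PP.exists_unique_line h).exists

section Finite

variable [Fintype Point]

open Classical in
/-- The points that are not saturated by `S`. -/
noncomputable def unsaturated (PP : ProjPlane Point Line q) (S : Finset Point) : Finset Point :=
  {x | ¬ PP.Saturated (S : Set Point) x}

theorem mem_unsaturated (PP : ProjPlane Point Line q) {S : Finset Point} {x : Point} :
    x ∈ PP.unsaturated S ↔ ¬ PP.Saturated (S : Set Point) x := by
  simp [unsaturated]

theorem unsaturated_anti (PP : ProjPlane Point Line q) {S T : Finset Point} (h : S ⊆ T) :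
    PP.unsaturated T ⊆ PP.unsaturated S := by
  intro x hx
  rw [mem_unsaturated] at hx ⊢
  exact fun hS => hx (hS.mono PP (by exact_mod_cast h))

theorem saturatingSet_of_unsaturated_eq_empty (PP : ProjPlane Point Line q) {S : Finset Point}
    (h : PP.unsaturated S = ∅) : PP.SaturatingSet (S : Set Point) := by
  intro x
  by_contra hx
  exact notMem_empty x (h ▸ PP.mem_unsaturated.2 hx)

open Classical in
/-- Through an unsaturated point `x` there are at most `q + 1 - #S` lines missing `S`. -/
theorem card_lines_missing_le [Fintype Line] (PP : ProjPlane Point Line q) {S : Finset Point}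
    {x : Point} (hx : x ∈ PP.unsaturated S) :
    #{l : Line | PP.Incid x l ∧ ∀ s ∈ S, ¬ PP.Incid s l} ≤ q + 1 - #S := by
  rw [mem_unsaturated] at hx
  have hxS : ∀ s ∈ S, x ≠ s := fun s hs h => hx (Or.inl (by simpa [h] using hs))
  have : Nonempty Line := (Nat.card_pos_iff.1 (by rw [PP.card_lines]; omega)).1
  choose! f hf using fun s (hs : s ∈ S) => PP.exists_line (hxS s hs)
  have hinj : Set.InjOn f S := by
    intro s hs t ht hst
    by_contra hne
    exact hx (Or.inr ⟨f s, (hf s hs).1, s, hs, t, ht, hne, (hf s hs).2, hst ▸ (hf t ht).2⟩)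
  have hdisj : Disjoint ({l : Line | PP.Incid x l ∧ ∀ s ∈ S, ¬ PP.Incid s l} : Finset Line)
      (S.image f) := by
    rw [Finset.disjoint_left]
    intro l hl hl'
    obtain ⟨s, hs, rfl⟩ := mem_image.1 hl'
    exact (mem_filter.1 hl).2.2 s hs (hf s hs).2
  have hsub : ({l : Line | PP.Incid x l ∧ ∀ s ∈ S, ¬ PP.Incid s l} : Finset Line) ∪ S.image f ⊆
      ({l : Line | PP.Incid x l} : Finset Line) := by
    intro l hl
    rcases mem_union.1 hl with hl | hl
    · exact mem_filter.2 ⟨mem_univ _, (mem_filter.1 hl).2.1⟩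
    · obtain ⟨s, hs, rfl⟩ := mem_image.1 hl
      exact mem_filter.2 ⟨mem_univ _, (hf s hs).1⟩
  have hcard := card_le_card hsub
  have hx1 : #({l : Line | PP.Incid x l} : Finset Line) = q + 1 := by
    rw [← PP.card_point_lines x, Nat.card_eq_fintype_card, Fintype.card_subtype]
  rw [card_union_of_disjoint hdisj, card_image_of_injOn hinj, hx1] at hcard
  omega

open Classical in
/-- An unsaturated point `x` stays unsaturated for at most `(q + 1 - #S) * q` choices of a
new point. -/
theorem card_stays_unsaturated_le [Fintype Line] (PP : ProjPlane Point Line q)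
    {S : Finset Point} {x : Point} (hx : x ∈ PP.unsaturated S) :
    #{p ∈ Sᶜ | x ∈ PP.unsaturated (insert p S)} ≤ (q + 1 - #S) * q := by
  have hsub : ({p ∈ Sᶜ | x ∈ PP.unsaturated (insert p S)} : Finset Point) ⊆
      ({l : Line | PP.Incid x l ∧ ∀ s ∈ S, ¬ PP.Incid s l} : Finset Line).biUnion
        (fun l => ({p : Point | PP.Incid p l} : Finset Point).erase x) := by
    intro p hp
    rw [mem_filter, mem_compl, mem_unsaturated] at hp
    obtain ⟨hpS, hp⟩ := hp
    have hxp : x ≠ p := by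
      rintro rfl
      exact hp (Or.inl (by simp))
    obtain ⟨l, hxl, hpl⟩ := PP.exists_line hxp
    refine mem_biUnion.2 ⟨l, mem_filter.2 ⟨mem_univ _, hxl, fun s hs hsl => ?_⟩, by
      simp [hxp.symm, hpl]⟩
    exact hp (Or.inr ⟨l, hxl, s, by simp [hs], p, by simp, fun h => hpS (h ▸ hs), hsl, hpl⟩)
  refine (card_le_card hsub).trans ((card_biUnion_le_card_mul _ _ q fun l hl => ?_).trans
    (Nat.mul_le_mul_right _ (PP.card_lines_missing_le hx)))
  have hxl : x ∈ ({p : Point | PP.Incid p l} : Finset Point) :=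
    mem_filter.2 ⟨mem_univ _, (mem_filter.1 hl).2.1⟩
  have hl1 : #({p : Point | PP.Incid p l} : Finset Point) = q + 1 := by
    rw [← PP.card_line_points l, Nat.card_eq_fintype_card, Fintype.card_subtype]
  rw [card_erase_of_mem hxl, hl1, Nat.add_sub_cancel]

open Classical in
/-- Averaging over all new points, some point reduces the number of unsaturated points by the
expected factor. -/
theorem exists_insert_card_unsaturated_le [Fintype Line] (PP : ProjPlane Point Line q)
    {S : Finset Point} (hS : (PP.unsaturated S).Nonempty) :
    ∃ p ∉ S, #(PP.unsaturated (insert p S)) ≤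
      #(PP.unsaturated S) * ((q + 1 - #S) * q) / (q ^ 2 + q + 1 - #S) := by
  have hne : Sᶜ.Nonempty := by
    obtain ⟨x, hx⟩ := hS
    refine ⟨x, mem_compl.2 fun h => PP.mem_unsaturated.1 hx (Or.inl h)⟩
  have hcompl : #Sᶜ = q ^ 2 + q + 1 - #S := by
    rw [card_compl, ← Nat.card_eq_fintype_card, PP.card_points]
  have hpos := hcompl ▸ hne.card_pos
  have hsum : ∑ p ∈ Sᶜ, #(PP.unsaturated (insert p S)) ≤
      #(PP.unsaturated S) * ((q + 1 - #S) * q) := by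
    calc ∑ p ∈ Sᶜ, #(PP.unsaturated (insert p S))
        = ∑ p ∈ Sᶜ, #{x ∈ PP.unsaturated S | x ∈ PP.unsaturated (insert p S)} := by
          refine sum_congr rfl fun p _ => ?_
          rw [filter_mem_eq_inter, inter_eq_right.2 (PP.unsaturated_anti (subset_insert p S))]
      _ = ∑ x ∈ PP.unsaturated S, #{p ∈ Sᶜ | x ∈ PP.unsaturated (insert p S)} :=
          (sum_card_bipartiteAbove_eq_sum_card_bipartiteBelow
            (fun p x => x ∈ PP.unsaturated (insert p S)))
      _ ≤ #(PP.unsaturated S) * ((q + 1 - #S) * q) := by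
          rw [← smul_eq_mul]
          exact sum_le_card_nsmul _ _ _ fun x hx => PP.card_stays_unsaturated_le hx
  obtain ⟨p, hp, hmin⟩ := exists_min_image Sᶜ (fun p => #(PP.unsaturated (insert p S))) hne
  refine ⟨p, mem_compl.1 hp, (Nat.le_div_iff_mul_le hpos).2 (le_trans ?_ hsum)⟩
  rw [← hcompl, mul_comm, ← smul_eq_mul]
  exact card_nsmul_le_sum _ _ _ hmin

end Finite

/-- An upper bound for the number of points left unsaturated by the first `i` greedily chosen
points in a projective plane of order `q`. -/
def greedyBound (q : ℕ) : ℕ → ℕ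
  | 0 => q ^ 2 + q + 1
  | i + 1 => greedyBound q i * ((q + 1 - i) * q) / (q ^ 2 + q + 1 - i)

theorem exists_card_unsaturated_le_greedyBound [Fintype Point] [Fintype Line]
    (PP : ProjPlane Point Line q) (i : ℕ) :
    ∃ S : Finset Point, #S ≤ i ∧ #(PP.unsaturated S) ≤ greedyBound q i ∧
      (#S = i ∨ PP.unsaturated S = ∅) := by
  classical
  induction i with
  | zero =>
    refine ⟨∅, le_rfl, ?_, Or.inl rfl⟩
    rw [greedyBound, ← PP.card_points, Nat.card_eq_fintype_card]
    exact card_le_univ _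
  | succ i ih =>
    obtain ⟨S, hSi, hS, hor⟩ := ih
    rcases (PP.unsaturated S).eq_empty_or_nonempty with h | h
    · exact ⟨S, by omega, by simp [h], Or.inr h⟩
    · have hcard : #S = i := hor.resolve_right h.ne_empty
      obtain ⟨p, hp, hle⟩ := PP.exists_insert_card_unsaturated_le h
      have hins : #(insert p S) = i + 1 := by rw [card_insert_of_notMem hp, hcard]
      refine ⟨insert p S, hins.le, hle.trans ?_, Or.inl hins⟩
      rw [greedyBound, hcard]
      gcongr

/-- Two unsaturated points can be saturated by adding a single point. -/
theorem exists_saturating_pair (PP : ProjPlane Point Line q) {S : Set Point} (hS : S.Nontrivial)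
    {x y : Point} (hx : ¬ PP.Saturated S x) (hy : ¬ PP.Saturated S y) :
    ∃ z, PP.Saturated (insert z S) x ∧ PP.Saturated (insert z S) y := by
  obtain ⟨s, hs, t, ht, hst⟩ := hS
  obtain ⟨l, hxl, hsl⟩ := PP.exists_line (x := x) (y := s) fun h => hx (Or.inl (h ▸ hs))
  obtain ⟨m, hym, htm⟩ := PP.exists_line (x := y) (y := t) fun h => hy (Or.inl (h ▸ ht))
  have hlm : l ≠ m := by
    rintro rfl
    exact hx (Or.inr ⟨l, hxl, s, hs, t, ht, hst, hsl, htm⟩)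
  obtain ⟨z, hzl, hzm⟩ := (PP.exists_unique_point hlm).exists
  refine ⟨z, Or.inr ⟨l, hxl, s, by simp [hs], z, by simp, ?_, hsl, hzl⟩,
    Or.inr ⟨m, hym, t, by simp [ht], z, by simp, ?_, htm, hzm⟩⟩
  · rintro rfl
    exact hy (Or.inr ⟨m, hym, s, hs, t, ht, hst, hzm, htm⟩)
  · rintro rfl
    exact hx (Or.inr ⟨l, hxl, s, hs, t, ht, hst, hsl, hzl⟩)

theorem exists_saturatingSet_card_le_add [Fintype Point] (PP : ProjPlane Point Line q) (m : ℕ)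
    (S : Finset Point) (hS : 2 ≤ #S) (hU : #(PP.unsaturated S) ≤ 2 * m) :
    ∃ T : Finset Point, PP.SaturatingSet (T : Set Point) ∧ #T ≤ #S + m := by
  classical
  induction m generalizing S with
  | zero =>
    exact ⟨S, PP.saturatingSet_of_unsaturated_eq_empty (card_eq_zero.1 (by omega)), le_rfl⟩
  | succ m ih =>
    obtain ⟨z, hz⟩ : ∃ z, #(PP.unsaturated (insert z S)) ≤ 2 * m := by
      rcases le_or_gt #(PP.unsaturated S) 1 with h1 | h1
      · rcases (PP.unsaturated S).eq_empty_or_nonempty with h | ⟨x, hx⟩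
        · obtain ⟨z, hz⟩ := card_pos.1 (by omega : 0 < #S)
          exact ⟨z, by simp [insert_eq_of_mem hz, h]⟩
        · refine ⟨x, ?_⟩
          have : #(PP.unsaturated (insert x S)) < #(PP.unsaturated S) :=
            card_lt_card ⟨PP.unsaturated_anti (subset_insert _ _), fun h =>
              PP.mem_unsaturated.1 (h hx) (Or.inl (by simp))⟩
          omega
      · obtain ⟨x, hx, y, hy, hxy⟩ := one_lt_card.1 h1
        obtain ⟨z, hzx, hzy⟩ := PP.exists_saturating_pair
          (S := (S : Set Point)) (one_lt_card_iff_nontrivial.1 (by omega))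
          (PP.mem_unsaturated.1 hx) (PP.mem_unsaturated.1 hy)
        refine ⟨z, ?_⟩
        have hsub : PP.unsaturated (insert z S) ⊆ ((PP.unsaturated S).erase x).erase y := by
          intro w hw
          refine mem_erase.2 ⟨?_, mem_erase.2 ⟨?_, PP.unsaturated_anti (subset_insert _ _) hw⟩⟩
          · rintro rfl
            exact PP.mem_unsaturated.1 hw (by simpa using hzy)
          · rintro rfl
            exact PP.mem_unsaturated.1 hw (by simpa using hzx)
        have := card_le_card hsub
        rw [card_erase_of_mem (mem_erase.2 ⟨hxy.symm, hy⟩), card_erase_of_mem hx] at this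
        omega
    obtain ⟨T, hT, hTc⟩ := ih (insert z S) (hS.trans (card_le_card (subset_insert _ _))) hz
    exact ⟨T, hT, by have := card_insert_le z S; omega⟩

theorem exists_saturatingSet_of_greedyBound_le [Fintype Point] [Fintype Line]
    (PP : ProjPlane Point Line q) {k m : ℕ} (hk : 2 ≤ k) (h : greedyBound q k ≤ 2 * m) :
    ∃ S : Set Point, PP.SaturatingSet S ∧ S.ncard ≤ k + m := by
  obtain ⟨S, hSk, hS, hor⟩ := PP.exists_card_unsaturated_le_greedyBound k
  rcases hor with hcard | hemp
  · obtain ⟨T, hT, hTc⟩ := PP.exists_saturatingSet_card_le_add m S (by omega) (hS.trans h)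
    exact ⟨T, hT, by rw [Set.ncard_coe_finset]; omega⟩
  · exact ⟨S, PP.saturatingSet_of_unsaturated_eq_empty hemp, by
      rw [Set.ncard_coe_finset]; omega⟩

end ProjPlane

theorem Real.one_sub_le_exp_neg_sub_sq {x : ℝ} (hx : 0 ≤ x) :
    1 - x ≤ Real.exp (-(x + x ^ 2 / 2)) := by
  rcases lt_or_ge x 1 with h1 | h1
  · have hs := Real.hasSum_pow_div_log_of_abs_lt_one (x := x) (by rwa [abs_of_nonneg hx])
    have := sum_le_hasSum (Finset.range 2) (fun n _ => by positivity) hs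
    norm_num [Finset.sum_range_succ] at this
    rw [← Real.log_le_iff_le_exp (by linarith)]
    linarith
  · exact le_trans (by linarith) (Real.exp_pos _).le

namespace ProjPlane

theorem greedyBound_two {q : ℕ} (hq : 1 ≤ q) : greedyBound q 2 = q ^ 2 := by
  have h1 : greedyBound q 1 = (q + 1) * q := by
    simp only [greedyBound, Nat.sub_zero]
    exact Nat.mul_div_cancel_left _ (by positivity)
  have h2 : q ^ 2 + q + 1 - 1 = (q + 1) * q := by rw [Nat.add_sub_cancel]; ring
  rw [greedyBound, h1, h2, Nat.add_sub_cancel, ← sq]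
  exact Nat.mul_div_cancel_left _ (by positivity)

theorem greedyBound_factor_le {q i : ℕ} :
    (((q + 1 - i) * q : ℕ) : ℝ) / ((q ^ 2 + q + 1 - i : ℕ) : ℝ) ≤
      Real.exp (-(i / (q + 2) + (i / (q + 2)) ^ 2 / 2)) := by
  rcases le_or_gt i (q + 1) with hi | hi
  · refine le_trans ?_ (Real.one_sub_le_exp_neg_sub_sq (by positivity))
    rcases Nat.eq_zero_or_pos q with rfl | hq
    · simp only [mul_zero, Nat.cast_zero, zero_div, zero_add]
      have : (i : ℝ) ≤ 1 := by exact_mod_cast hi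
      linarith
    have hi' : i ≤ q ^ 2 + q + 1 := by nlinarith
    have hlt : (i : ℝ) < q ^ 2 + q + 1 := by
      have : i < q ^ 2 + q + 1 := by nlinarith
      exact_mod_cast this
    rw [Nat.cast_mul, Nat.cast_sub hi, Nat.cast_sub hi']
    push_cast
    rw [div_le_iff₀ (by linarith), one_sub_div (by positivity), div_mul_eq_mul_div,
      le_div_iff₀ (by positivity)]
    have : (0 : ℝ) ≤ ((i : ℝ) - 1) * (i - 2) := by
      rcases Nat.lt_or_ge i 2 with h | h
      · interval_cases i <;> norm_num
      · have : (2 : ℝ) ≤ i := by exact_mod_cast h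
        exact mul_nonneg (by linarith) (by linarith)
    nlinarith
  · rw [Nat.sub_eq_zero_of_le hi.le]
    simpa using (Real.exp_pos _).le

theorem greedyBound_le_exp {q : ℕ} (hq : 1 ≤ q) {k : ℕ} (hk : 2 ≤ k) :
    (greedyBound q k : ℝ) ≤ q ^ 2 * Real.exp (-(((k : ℝ) * (k - 1) / 2 - 1) / (q + 2) +
      (((k : ℝ) - 1) * k * (2 * k - 1) / 6 - 1) / (2 * (q + 2) ^ 2))) := by
  induction k, hk using Nat.le_induction with
  | base =>
    rw [greedyBound_two hq]
    norm_num
  | succ k hk ih =>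
    rw [greedyBound]
    refine Nat.cast_div_le.trans ?_
    rw [Nat.cast_mul, mul_div_assoc]
    refine (mul_le_mul ih greedyBound_factor_le (by positivity) (by positivity)).trans_eq ?_
    rw [mul_assoc, ← Real.exp_add]
    congr 2
    push_cast
    field_simp
    ring

theorem greedyBound_le_sqrt {q k : ℕ} (hq : 22 ≤ q)
    (hk : Real.sqrt (3 * q * Real.log q) ≤ k) : (greedyBound q k : ℝ) ≤ Real.sqrt q := by
  have hqr : (22 : ℝ) ≤ q := by exact_mod_cast hq
  have hq0 : (0 : ℝ) < q := by linarith
  have hL : 3 ≤ Real.log q := by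
    rw [Real.le_log_iff_exp_le hq0]
    refine le_trans ?_ hqr
    have h3 : Real.exp 3 = Real.exp 1 ^ 3 := by rw [← Real.exp_nat_mul]; norm_num
    rw [h3]
    have := Real.exp_one_lt_d9
    calc Real.exp 1 ^ 3 ≤ 2.7182818286 ^ 3 := by gcongr
      _ ≤ 22 := by norm_num
  set L := Real.log q with hLdef
  set K := Real.sqrt (3 * q * L) with hKdef
  have hK2 : K ^ 2 = 3 * q * L := Real.sq_sqrt (by positivity)
  have hK14 : 14 ≤ K := Real.le_sqrt_of_sq_le (by nlinarith)
  have hk2 : 2 ≤ k := by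
    have : (2 : ℝ) ≤ k := by linarith
    exact_mod_cast this
  refine (greedyBound_le_exp (by omega) hk2).trans ?_
  have hexp : 3 / 2 * L ≤ ((k : ℝ) * (k - 1) / 2 - 1) / (q + 2) +
      (((k : ℝ) - 1) * k * (2 * k - 1) / 6 - 1) / (2 * (q + 2) ^ 2) := by
    have hmono : (K * (K - 1) / 2 - 1) / (q + 2) +
        ((K - 1) * K * (2 * K - 1) / 6 - 1) / (2 * (q + 2) ^ 2) ≤
        ((k : ℝ) * (k - 1) / 2 - 1) / (q + 2) +
        (((k : ℝ) - 1) * k * (2 * k - 1) / 6 - 1) / (2 * (q + 2) ^ 2) := by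
      have h1 : 0 ≤ K - 1 := by linarith
      have h2 : 0 ≤ 2 * K - 1 := by linarith
      have h3 : 0 ≤ (k : ℝ) - 1 := by linarith
      gcongr
    refine le_trans ?_ hmono
    have hmain : 15 / 2 * q * L + 2 * q + 5 + 12 * L ≤ K * (q * (L - 1) - 11 / 6) := by
      have h0 : 0 ≤ q * (L - 1) - 11 / 6 := by nlinarith
      have h1 := mul_le_mul_of_nonneg_right hK14 h0
      nlinarith [mul_nonneg (sub_nonneg.2 hqr) (sub_nonneg.2 hL)]
    have hsplit : (K * (K - 1) / 2 - 1) / (q + 2) +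
        ((K - 1) * K * (2 * K - 1) / 6 - 1) / (2 * (q + 2) ^ 2) - 3 / 2 * L =
        (K * (q * (L - 1) - 11 / 6) - (15 / 2 * q * L + 2 * q + 5 + 12 * L)) /
          (2 * (q + 2) ^ 2) := by
      have hK3 : K ^ 3 = K * (3 * q * L) := by rw [← hK2]; ring
      field_simp
      ring_nf
      rw [hK3, hK2]
      ring
    have := div_nonneg (sub_nonneg.2 hmain) (by positivity : (0 : ℝ) ≤ 2 * (q + 2) ^ 2)
    linarith
  have hsq : Real.sqrt q = q ^ 2 * Real.exp (-(3 / 2 * L)) := by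
    have h1 : (q : ℝ) = Real.exp L := (Real.exp_log hq0).symm
    rw [Real.sqrt_eq_rpow, Real.rpow_def_of_pos hq0, ← hLdef]
    nth_rewrite 1 [h1]
    rw [← Real.exp_nat_mul, ← Real.exp_add]
    congr 1
    push_cast
    ring
  rw [hsq]
  gcongr

theorem lt_ceil_sqrt_mul_log {q k : ℕ} (hq : 0 < q) (hk : k ≠ 0)
    (h : 27183 ^ (k ^ 2) ≤ 10000 ^ (k ^ 2) * q ^ (3 * q)) :
    k < ⌈Real.sqrt (3 * q * Real.log q)⌉₊ := by
  rw [Nat.lt_ceil]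
  have hq0 : (0 : ℝ) < q := by exact_mod_cast hq
  apply Real.lt_sqrt_of_sq_lt
  have h1 : Real.exp ((k : ℝ) ^ 2) < (q : ℝ) ^ (3 * q) := by
    have he : Real.exp ((k : ℝ) ^ 2) = Real.exp 1 ^ (k ^ 2) := by
      rw [← Real.exp_nat_mul]
      push_cast
      ring_nf
    rw [he]
    calc Real.exp 1 ^ (k ^ 2) < (27183 / 10000) ^ (k ^ 2) := by
          refine pow_lt_pow_left₀ (Real.exp_one_lt_d9.trans (by norm_num))
            (Real.exp_pos _).le (by positivity)
      _ ≤ (q : ℝ) ^ (3 * q) := by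
          rw [div_pow, div_le_iff₀ (by positivity), mul_comm]
          exact_mod_cast h
  rw [← Real.lt_log_iff_exp_lt (by positivity), Real.log_pow] at h1
  push_cast at h1
  exact h1

/-- For small orders `q`, the greedy bound drops far enough within the allowed number of steps. -/
theorem exists_greedyBound_le_of_lt {q : ℕ} (hq : 2 ≤ q) (hq' : q < 22) :
    ∃ k, 0 < k ∧ 27183 ^ (k ^ 2) ≤ 10000 ^ (k ^ 2) * q ^ (3 * q) ∧
      greedyBound q (k + 1) ≤ if q < 10 then 4 else 6 := by
  interval_cases q
  · exact ⟨2, by norm_num [greedyBound]⟩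
  · exact ⟨3, by norm_num [greedyBound]⟩
  · exact ⟨4, by norm_num [greedyBound]⟩
  · exact ⟨4, by norm_num [greedyBound]⟩
  · exact ⟨5, by norm_num [greedyBound]⟩
  · exact ⟨6, by norm_num [greedyBound]⟩
  · exact ⟨7, by norm_num [greedyBound]⟩
  · exact ⟨7, by norm_num [greedyBound]⟩
  · exact ⟨8, by norm_num [greedyBound]⟩
  · exact ⟨8, by norm_num [greedyBound]⟩
  · exact ⟨9, by norm_num [greedyBound]⟩
  · exact ⟨10, by norm_num [greedyBound]⟩
  · exact ⟨10, by norm_num [greedyBound]⟩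
  · exact ⟨11, by norm_num [greedyBound]⟩
  · exact ⟨11, by norm_num [greedyBound]⟩
  · exact ⟨12, by norm_num [greedyBound]⟩
  · exact ⟨12, by norm_num [greedyBound]⟩
  · exact ⟨12, by norm_num [greedyBound]⟩
  · exact ⟨13, by norm_num [greedyBound]⟩
  · exact ⟨13, by norm_num [greedyBound]⟩

end ProjPlane

/-- In any finite projective plane of order q ≥ 2 there is a saturating set of
size at most ⌈√(3q·ln q)⌉ + ⌈(√q + 1)/2⌉. -/
theorem exists_saturating_set_exact {Point Line : Type*} {q : ℕ} (hq : 2 ≤ q)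
    (PP : ProjPlane Point Line q) :
    ∃ S : Set Point, PP.SaturatingSet S ∧
      S.ncard ≤ ⌈Real.sqrt (3 * q * Real.log q)⌉₊ + ⌈(Real.sqrt q + 1) / 2⌉₊ := by
  have : Finite Point := Nat.finite_of_card_ne_zero (by rw [PP.card_points]; omega)
  have : Finite Line := Nat.finite_of_card_ne_zero (by rw [PP.card_lines]; omega)
  have := Fintype.ofFinite Point
  have := Fintype.ofFinite Line
  have hsqrt := Real.lt_sqrt_of_sq_lt (x := 1) (y := q) (by
    have : 1 < q := hq
    norm_num
    exact this)
  rcases Nat.lt_or_ge q 22 with hlt | hge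
  · obtain ⟨k, hk, hpow, hle⟩ := ProjPlane.exists_greedyBound_le_of_lt hq hlt
    have hceil := ProjPlane.lt_ceil_sqrt_mul_log (by omega) (by omega) hpow
    have hm : (if q < 10 then 4 else 6) ≤ 2 * ⌈(Real.sqrt q + 1) / 2⌉₊ := by
      split_ifs with h10
      · have : 1 < ⌈(Real.sqrt q + 1) / 2⌉₊ := Nat.lt_ceil.2 (by push_cast; linarith)
        omega
      · have h3 : (3 : ℝ) < Real.sqrt q := Real.lt_sqrt_of_sq_lt (by
          have : 9 < q := by omega
          norm_num
          exact_mod_cast this)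
        have : 2 < ⌈(Real.sqrt q + 1) / 2⌉₊ := Nat.lt_ceil.2 (by push_cast; linarith)
        omega
    obtain ⟨S, hS, hcard⟩ :=
      PP.exists_saturatingSet_of_greedyBound_le (by omega) (hle.trans hm)
    exact ⟨S, hS, by omega⟩
  · have hpow : 27183 ^ (1 ^ 2) ≤ 10000 ^ (1 ^ 2) * q ^ (3 * q) := by
      have : 22 ^ 1 ≤ q ^ (3 * q) :=
        (Nat.pow_le_pow_left hge 1).trans (Nat.pow_le_pow_right (by omega) (by omega))
      omega
    have hk := ProjPlane.lt_ceil_sqrt_mul_log (by omega) (by omega) hpow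
    refine PP.exists_saturatingSet_of_greedyBound_le hk ?_
    have hle := ProjPlane.greedyBound_le_sqrt hge (Nat.le_ceil _)
    have hm := Nat.le_ceil ((Real.sqrt q + 1) / 2)
    have : (ProjPlane.greedyBound q ⌈Real.sqrt (3 * q * Real.log q)⌉₊ : ℝ) ≤
        (2 * ⌈(Real.sqrt q + 1) / 2⌉₊ : ℕ) := by
      push_cast
      linarith
    exact_mod_cast this
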